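/- arXiv:1604.02305 — 2 statements merged into one kernel-verified Lean document; each statement's English description precedes it below -/
import Mathlib

section
/- Let a be a positive integer and b, m, n nonnegative integers with b ≤ a and m ≤ n. Then A(b,a;n,m) ∈ ℕ₀[q] if and only if A(b,a;n+la, m+ka) ∈ ℕ₀[q] for all integers k, l such that 0 ≤ m+ka ≤ n+la. -/
open Polynomial Finset

/-- `A(b,a;n,m) ∈ ℕ₀[q]`: the polynomial `(1-q^a)·∏_{i=1}^m (1-q^i)·∏_{i=1}^{n-m} (1-q^i)`
divides `(1-q^b)·∏_{i=1}^n (1-q^i)` in `ℤ[q]` and the quotient has nonnegative coefficients. -/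
def AIsNatPoly (b a n m : ℕ) : Prop :=
  ∃ c : Polynomial ℤ,
    ((1 - X ^ b) * ∏ i ∈ range n, (1 - X ^ (i + 1)) : Polynomial ℤ) =
      ((1 - X ^ a) * (∏ i ∈ range m, (1 - X ^ (i + 1))) *
        ∏ i ∈ range (n - m), (1 - X ^ (i + 1))) * c ∧
    ∀ k : ℕ, 0 ≤ c.coeff k

/-- For a graded `sl₂`-action, the raising operator is injective below the middle degree. -/
theorem LinearMap.eq_zero_of_graded_sl2 {K V : Type*} [Field K] [LinearOrder K]
    [IsStrictOrderedRing K] [AddCommGroup V] [Module K V] (U D : V →ₗ[K] V) (W : ℕ → Submodule K V)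
    (c : K) (hD : ∀ r, ∀ x ∈ W (r + 1), D x ∈ W r) (hD0 : ∀ x ∈ W 0, D x = 0)
    (hc : ∀ r, ∀ x ∈ W r, D (U x) - U (D x) = (c - 2 * r) • x)
    {r : ℕ} (hr : 2 * (r : K) < c) {x : V} (hx : x ∈ W r) (hU : U x = 0) : x = 0 := by
  have mem : ∀ j k, j + k = r → (D ^ k) x ∈ W j := by
    intro j k
    induction k generalizing j with
    | zero => rintro rfl; simpa using hx
    | succ k ih =>
      intro h
      rw [pow_succ', Module.End.mul_apply]
      exact hD _ _ (ih (j + 1) (by omega))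
  have key : ∀ k ≤ r, U ((D ^ (k + 1)) x) = -((k + 1) * (c - 2 * r + k)) • (D ^ k) x := by
    intro k
    induction k with
    | zero =>
      intro _
      have := hc r x hx
      rw [hU, map_zero, zero_sub, neg_eq_iff_eq_neg] at this
      simp [this, ← neg_smul]
    | succ k ih =>
      intro hk
      have h := hc (r - (k + 1)) _ (mem (r - (k + 1)) (k + 1) (by omega))
      rw [ih (by omega), map_smul, ← Module.End.mul_apply, ← pow_succ', ← Module.End.mul_apply D,
        ← pow_succ', Nat.cast_sub hk] at h
      rw [sub_eq_iff_eq_add, ← sub_eq_iff_eq_add', ← sub_smul] at h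
      rw [← h]
      congr 1
      push_cast
      ring
  have van : ∀ k ≤ r + 1, (D ^ (r + 1 - k)) x = 0 := by
    intro k
    induction k with
    | zero =>
      intro _
      rw [Nat.sub_zero, pow_succ', Module.End.mul_apply]
      exact hD0 _ (mem 0 r (by omega))
    | succ k ih =>
      intro hk
      have h := key (r - k) (by omega)
      rw [show r - k + 1 = r + 1 - k by omega, ih (by omega), map_zero] at h
      rw [show r + 1 - (k + 1) = r - k by omega]
      refine (smul_eq_zero.mp h.symm).resolve_left (neg_ne_zero.mpr (mul_ne_zero ?_ ?_))
      · positivity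
      · have : (0 : K) ≤ ((r - k : ℕ) : K) := by positivity
        linarith
  simpa using van (r + 1) le_rfl

/-- Exponent vectors in the variables `x_0, …, x_M` of degree `m` and weight `r`, where `x_i` has
weight `i`; equivalently, partitions of `r` in an `m × M` box. -/
noncomputable def boxExponents (M m r : ℕ) : Finset (ℕ →₀ ℕ) :=
  {s ∈ finsuppAntidiag (range (M + 1)) m | Finsupp.weight id s = r}

theorem mem_finsuppAntidiag_range_iff {N m : ℕ} {s : ℕ →₀ ℕ} :
    s ∈ finsuppAntidiag (range N) m ↔ s.degree = m ∧ ∀ i, N ≤ i → s i = 0 := by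
  rw [mem_finsuppAntidiag']
  refine and_congr Iff.rfl ⟨fun h i hi => ?_, fun h i hi => ?_⟩
  · by_contra h0
    have := mem_range.mp (h (Finsupp.mem_support_iff.mpr h0))
    omega
  · by_contra h0
    exact Finsupp.mem_support_iff.mp hi (h i (by simpa using h0))

theorem mem_boxExponents {M m r : ℕ} {s : ℕ →₀ ℕ} :
    s ∈ boxExponents M m r ↔
      (s.degree = m ∧ ∀ i, M + 1 ≤ i → s i = 0) ∧ Finsupp.weight id s = r := by
  rw [boxExponents, mem_filter, mem_finsuppAntidiag_range_iff]

theorem add_single_mem_boxExponents {M m r r' i j : ℕ} {u : ℕ →₀ ℕ}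
    (hu : u + Finsupp.single i 1 ∈ boxExponents M m r) (hj : j ≤ M) (h : j + r = i + r') :
    u + Finsupp.single j 1 ∈ boxExponents M m r' := by
  simp only [mem_boxExponents, map_add, Finsupp.degree_single, Finsupp.weight_single,
    Finsupp.add_apply, id, smul_eq_mul, one_mul] at hu ⊢
  refine ⟨⟨hu.1.1, fun k hk => ?_⟩, by omega⟩
  have := hu.1.2 k hk
  rw [Finsupp.single_eq_of_ne (by omega)]
  omega

/-- The raising operator of `sl₂` acting on the symmetric powers of its irreducible
representation of dimension `M + 1`. -/
noncomputable def raising (M : ℕ) : Derivation ℚ (MvPolynomial ℕ ℚ) (MvPolynomial ℕ ℚ) :=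
  MvPolynomial.mkDerivation ℚ fun i => ((M : ℚ) - i) • MvPolynomial.X (i + 1)

/-- The lowering operator matching `raising`. -/
noncomputable def lowering : Derivation ℚ (MvPolynomial ℕ ℚ) (MvPolynomial ℕ ℚ) :=
  MvPolynomial.mkDerivation ℚ fun i => (i : ℚ) • MvPolynomial.X (i - 1)

theorem lie_lowering_raising (M : ℕ) : ⁅lowering, raising M⁆ =
    MvPolynomial.mkDerivation ℚ fun i : ℕ => ((M : ℚ) - 2 * i) • MvPolynomial.X i := by
  refine MvPolynomial.derivation_ext fun i => ?_
  rw [Derivation.commutator_apply]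
  cases i with
  | zero => simp [lowering, raising]
  | succ i =>
    simp only [lowering, raising, MvPolynomial.mkDerivation_X, Derivation.map_smul, smul_smul,
      Nat.add_sub_cancel, ← sub_smul]
    congr 1
    push_cast
    ring

theorem mkDerivation_smul_X_monomial (w : ℕ → ℚ) (s : ℕ →₀ ℕ) :
    MvPolynomial.mkDerivation ℚ (fun i => w i • MvPolynomial.X i) (MvPolynomial.monomial s 1) =
      (s.sum fun i k => k * w i) • MvPolynomial.monomial s (1 : ℚ) := by
  rw [MvPolynomial.mkDerivation_monomial, one_smul, Finsupp.sum, Finsupp.sum, sum_smul]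
  refine sum_congr rfl fun i hi => ?_
  rw [smul_eq_mul, mul_smul_comm, MvPolynomial.X, MvPolynomial.monomial_mul,
    Finsupp.sub_add_single_one_cancel (Finsupp.mem_support_iff.mp hi), MvPolynomial.smul_monomial,
    MvPolynomial.smul_monomial]
  congr 1
  simp [mul_comm]

theorem mkDerivation_mem_restrictSupport_boxExponents {M m r r' : ℕ} (f : ℕ → ℕ) (w : ℕ → ℚ)
    (hf : ∀ i ≤ M, w i ≠ 0 → f i ≤ M ∧ f i + r = i + r') {p : MvPolynomial ℕ ℚ}
    (hp : p ∈ MvPolynomial.restrictSupport ℚ (boxExponents M m r : Set (ℕ →₀ ℕ))) :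
    MvPolynomial.mkDerivation ℚ (fun i => w i • MvPolynomial.X (f i)) p ∈
      MvPolynomial.restrictSupport ℚ (boxExponents M m r' : Set (ℕ →₀ ℕ)) := by
  rw [MvPolynomial.restrictSupport_eq_span] at hp
  induction hp using Submodule.span_induction with
  | zero => simp
  | add x y _ _ hx hy => simpa using add_mem hx hy
  | smul c x _ hx => simpa using Submodule.smul_mem _ c hx
  | mem x hx =>
    obtain ⟨s, hs, rfl⟩ := hx
    rw [MvPolynomial.mkDerivation_monomial, one_smul]
    refine Submodule.sum_mem _ fun i hi => ?_
    have hsi := Finsupp.mem_support_iff.mp hi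
    simp only [smul_eq_mul, mul_smul_comm, MvPolynomial.X, MvPolynomial.monomial_mul]
    by_cases hw : w i = 0
    · simp [hw]
    have hiM : i ≤ M := by
      by_contra h
      exact hsi ((mem_boxExponents.mp hs).1.2 i (by omega))
    obtain ⟨h1, h2⟩ := hf i hiM hw
    refine Submodule.smul_mem _ _ ((MvPolynomial.monomial_mem_restrictSupport ℚ).mpr (Or.inl ?_))
    refine add_single_mem_boxExponents (i := i) (r := r) ?_ h1 h2
    rwa [Finsupp.sub_add_single_one_cancel hsi]

theorem lie_lowering_raising_apply {M m r : ℕ} {p : MvPolynomial ℕ ℚ}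
    (hp : p ∈ MvPolynomial.restrictSupport ℚ (boxExponents M m r : Set (ℕ →₀ ℕ))) :
    lowering (raising M p) - raising M (lowering p) = ((M * m : ℚ) - 2 * r) • p := by
  rw [← Derivation.commutator_apply, lie_lowering_raising]
  rw [MvPolynomial.restrictSupport_eq_span] at hp
  induction hp using Submodule.span_induction with
  | zero => simp
  | add x y _ _ hx hy => rw [map_add, hx, hy, smul_add]
  | smul c x _ hx => rw [Derivation.map_smul, hx, smul_comm]
  | mem x hx =>
    obtain ⟨s, hs, rfl⟩ := hx
    rw [mkDerivation_smul_X_monomial]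
    congr 1
    obtain ⟨⟨rfl, -⟩, rfl⟩ := mem_boxExponents.mp hs
    rw [Finsupp.degree_apply, Finsupp.weight_apply, Finsupp.sum, Finsupp.sum]
    push_cast
    rw [mul_sum, mul_sum, ← sum_sub_distrib]
    refine sum_congr rfl fun i _ => ?_
    simp only [id, smul_eq_mul]
    push_cast
    ring

/-- The number of partitions of `r` in a box is weakly increasing up to the middle rank. -/
theorem card_boxExponents_le_succ {M m r : ℕ} (h : 2 * r < M * m) :
    #(boxExponents M m r) ≤ #(boxExponents M m (r + 1)) := by
  let W (r : ℕ) := MvPolynomial.restrictSupport ℚ (boxExponents M m r : Set (ℕ →₀ ℕ))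
  have hdim (r : ℕ) : Module.finrank ℚ (W r) = #(boxExponents M m r) := by
    rw [Module.finrank_eq_card_basis (MvPolynomial.basisRestrictSupport ℚ _)]
    simp
  have : Module.Finite ℚ (W (r + 1)) :=
    Module.Finite.of_basis (MvPolynomial.basisRestrictSupport ℚ _)
  have hU : ∀ x ∈ W r, raising M x ∈ W (r + 1) := fun x hx =>
    mkDerivation_mem_restrictSupport_boxExponents (fun i => i + 1) _ (fun i hi hw => by
      have : i ≠ M := by rintro rfl; simp at hw
      omega) hx
  rw [← hdim, ← hdim]
  refine LinearMap.finrank_le_finrank_of_injective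
    (f := ((raising M : MvPolynomial ℕ ℚ →ₗ[ℚ] MvPolynomial ℕ ℚ)).restrict hU) ?_
  rw [injective_iff_map_eq_zero]
  rintro ⟨x, hx⟩ h0
  have hUx : raising M x = 0 := congrArg Subtype.val h0
  ext1
  refine LinearMap.eq_zero_of_graded_sl2 (raising M : MvPolynomial ℕ ℚ →ₗ[ℚ] MvPolynomial ℕ ℚ)
    (lowering : MvPolynomial ℕ ℚ →ₗ[ℚ] MvPolynomial ℕ ℚ) W (M * m) ?_ ?_ ?_ (r := r)
    (by exact_mod_cast h) hx hUx
  · refine fun r x hx => mkDerivation_mem_restrictSupport_boxExponents _ _ (fun i hi hw => ?_) hx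
    have : i ≠ 0 := by rintro rfl; simp at hw
    omega
  · intro x hx
    simp only [W, MvPolynomial.restrictSupport_eq_span] at hx
    change lowering x = 0
    induction hx using Submodule.span_induction with
    | zero => simp
    | add x y _ _ hx hy => simp [hx, hy]
    | smul c x _ hx => simp [hx]
    | mem x hx =>
      obtain ⟨s, hs, rfl⟩ := hx
      rw [lowering, MvPolynomial.mkDerivation_monomial, one_smul]
      refine sum_eq_zero fun i hi => ?_
      have : i = 0 := by
        have := Finsupp.le_weight_of_ne_zero' id (Finsupp.mem_support_iff.mp hi)
        rw [(mem_boxExponents.mp hs).2] at this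
        simpa using this
      simp [this]
  · exact fun r x hx => lie_lowering_raising_apply hx

/-- The product `(1 - q)(1 - q²)⋯(1 - qⁿ)`. -/
noncomputable def qProd (n : ℕ) : ℤ[X] := ∏ i ∈ range n, (1 - X ^ (i + 1))

theorem qProd_zero : qProd 0 = 1 := rfl

theorem qProd_succ (n : ℕ) : qProd (n + 1) = qProd n * (1 - X ^ (n + 1)) :=
  prod_range_succ _ _

/-- The generating function of partitions in an `m × M` box, by size. -/
noncomputable def boxGenFun (M m : ℕ) : ℤ[X] :=
  ∑ s ∈ finsuppAntidiag (range (M + 1)) m, X ^ Finsupp.weight id s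

theorem coeff_boxGenFun (M m r : ℕ) : (boxGenFun M m).coeff r = #(boxExponents M m r) := by
  simp only [boxGenFun, boxExponents, finsetSum_coeff, coeff_X_pow, eq_comm (a := r), sum_boole]

theorem boxGenFun_zero_right (M : ℕ) : boxGenFun M 0 = 1 := by
  simp [boxGenFun]

theorem boxGenFun_zero_left (m : ℕ) : boxGenFun 0 m = 1 := by
  have : finsuppAntidiag (range (0 + 1)) m = {Finsupp.single 0 m} := by
    ext s
    rw [mem_finsuppAntidiag_range_iff, mem_singleton]
    constructor
    · rintro ⟨rfl, h⟩
      have hs : s = Finsupp.single 0 (s 0) := by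
        ext i
        rcases i with _ | i
        · simp
        · simp [h (i + 1)]
      rw [hs]
      simp
    · rintro rfl
      refine ⟨by simp, fun i hi => Finsupp.single_eq_of_ne (by omega)⟩
  rw [boxGenFun, this, sum_singleton, Finsupp.weight_single]
  simp

theorem boxGenFun_succ_succ (M m : ℕ) : boxGenFun (M + 1) (m + 1) =
    boxGenFun M (m + 1) + X ^ (M + 1) * boxGenFun (M + 1) m := by
  rw [boxGenFun, ← sum_filter_add_sum_filter_not _ (fun s => s (M + 1) = 0)]
  congr 1
  · refine sum_congr ?_ fun _ _ => rfl
    ext s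
    rw [mem_filter, mem_finsuppAntidiag_range_iff, mem_finsuppAntidiag_range_iff, and_assoc]
    refine and_congr_right fun _ =>
      ⟨fun h i hi => ?_, fun h => ⟨fun i hi => h i (by omega), h _ le_rfl⟩⟩
    rcases hi.eq_or_lt with rfl | hi
    · exact h.2
    · exact h.1 i hi
  · rw [boxGenFun, mul_sum]
    symm
    refine sum_nbij' (fun s => s + Finsupp.single (M + 1) 1) (fun s => s - Finsupp.single (M + 1) 1)
      ?_ ?_ ?_ ?_ ?_
    · intro s hs
      rw [mem_filter]
      rw [mem_finsuppAntidiag_range_iff] at hs ⊢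
      refine ⟨⟨by simp [hs.1], fun i hi => ?_⟩, by simp⟩
      rw [Finsupp.add_apply, hs.2 i hi, Finsupp.single_eq_of_ne (by omega), add_zero]
    · intro s hs
      rw [mem_filter] at hs
      obtain ⟨hs, h0⟩ := hs
      rw [mem_finsuppAntidiag_range_iff] at hs ⊢
      have := Finsupp.sub_add_single_one_cancel h0
      refine ⟨?_, fun i hi => ?_⟩
      · have h := hs.1
        rw [← this, map_add, Finsupp.degree_single] at h
        omega
      · rw [Finsupp.tsub_apply, hs.2 i hi, Nat.zero_sub]
    · intro s _
      simp
    · intro s hs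
      exact Finsupp.sub_add_single_one_cancel (mem_filter.mp hs).2
    · intro s _
      rw [map_add, Finsupp.weight_single, one_smul, id, ← pow_add, add_comm (M + 1)]

theorem boxGenFun_mul_qProd (M m : ℕ) :
    boxGenFun M m * (qProd m * qProd M) = qProd (m + M) := by
  induction M generalizing m with
  | zero => simp [boxGenFun_zero_left, qProd_zero]
  | succ M ihM =>
    induction m with
    | zero => simp [boxGenFun_zero_right, qProd_zero]
    | succ m ihm =>
      have h1 := ihM (m + 1)
      rw [show m + 1 + M = m + (M + 1) by omega] at h1
      rw [boxGenFun_succ_succ, show m + 1 + (M + 1) = m + (M + 1) + 1 by omega,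
        qProd_succ (m + (M + 1))]
      calc _ = (1 - X ^ (M + 1)) * (boxGenFun M (m + 1) * (qProd (m + 1) * qProd M)) +
            X ^ (M + 1) * (1 - X ^ (m + 1)) *
              (boxGenFun (M + 1) m * (qProd m * qProd (M + 1))) := by
            rw [qProd_succ m, qProd_succ M]; ring
        _ = _ := by rw [h1, ihm]; ring

theorem one_sub_X_pow_ne_zero {R : Type*} [Ring R] [Nontrivial R] {a : ℕ} (ha : 0 < a) :
    (1 - X ^ a : R[X]) ≠ 0 := by
  rw [← neg_ne_zero, neg_sub]
  exact (monic_X_pow_sub_C (1 : R) ha.ne').ne_zero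

theorem natDegree_one_sub_X_pow {R : Type*} [Ring R] [Nontrivial R] (a : ℕ) :
    (1 - X ^ a : R[X]).natDegree = a := by
  rw [← natDegree_neg, neg_sub]
  exact natDegree_X_pow_sub_C

theorem reverse_one_sub_X_pow {R : Type*} [Ring R] [Nontrivial R] (a : ℕ) :
    (1 - X ^ a : R[X]).reverse = -(1 - X ^ a) := by
  rw [reverse, natDegree_one_sub_X_pow, reflect_sub, ← C_1, reflect_C, ← one_mul (X ^ a),
    ← C_1, reflect_C_mul_X_pow, revAt_le le_rfl]
  simp

theorem qProd_ne_zero (n : ℕ) : qProd n ≠ 0 :=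
  prod_ne_zero_iff.mpr fun i _ => one_sub_X_pow_ne_zero i.succ_pos

theorem natDegree_qProd (n : ℕ) : 2 * (qProd n).natDegree = n * (n + 1) := by
  induction n with
  | zero => simp [qProd_zero]
  | succ n ih =>
    rw [qProd_succ, natDegree_mul (qProd_ne_zero n) (one_sub_X_pow_ne_zero n.succ_pos),
      natDegree_one_sub_X_pow, mul_add, ih, Nat.succ_eq_add_one]
    ring

theorem reverse_qProd (n : ℕ) : (qProd n).reverse = (-1) ^ n * qProd n := by
  induction n with
  | zero => rw [qProd_zero, pow_zero, one_mul, ← C_1, reverse_C]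
  | succ n ih =>
    rw [qProd_succ, reverse_mul_of_domain, reverse_one_sub_X_pow, ih]
    ring

theorem boxGenFun_ne_zero (M m : ℕ) : boxGenFun M m ≠ 0 :=
  left_ne_zero_of_mul (boxGenFun_mul_qProd M m ▸ qProd_ne_zero _)

theorem natDegree_boxGenFun (M m : ℕ) : (boxGenFun M m).natDegree = M * m := by
  have h := congrArg natDegree (boxGenFun_mul_qProd M m)
  rw [natDegree_mul (boxGenFun_ne_zero M m) (mul_ne_zero (qProd_ne_zero m) (qProd_ne_zero M)),
    natDegree_mul (qProd_ne_zero m) (qProd_ne_zero M)] at h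
  have h1 := natDegree_qProd m
  have h2 := natDegree_qProd M
  have h3 := natDegree_qProd (m + M)
  nlinarith

theorem reverse_boxGenFun (M m : ℕ) : (boxGenFun M m).reverse = boxGenFun M m := by
  have h := congrArg reverse (boxGenFun_mul_qProd M m)
  rw [reverse_mul_of_domain, reverse_mul_of_domain, reverse_qProd, reverse_qProd, reverse_qProd,
    ← boxGenFun_mul_qProd M m, pow_add] at h
  refine mul_right_cancel₀ (b := (-1) ^ m * (-1) ^ M * (qProd m * qProd M)) ?_ ?_
  · exact mul_ne_zero (by simp) (mul_ne_zero (qProd_ne_zero m) (qProd_ne_zero M))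
  · linear_combination h

theorem coeff_boxGenFun_mono {M m r r' : ℕ} (h : r ≤ r') (h' : 2 * r' ≤ M * m) :
    (boxGenFun M m).coeff r ≤ (boxGenFun M m).coeff r' := by
  induction r', h using Nat.le_induction with
  | base => rfl
  | succ k _ ih =>
    refine (ih (by omega)).trans ?_
    rw [coeff_boxGenFun, coeff_boxGenFun]
    exact_mod_cast card_boxExponents_le_succ (by omega)

/-- A polynomial multiple of a Gaussian polynomial by `(1 - q^b) / (1 - q^a)` has nonnegative
coefficients. -/
theorem coeff_nonneg_of_mul_boxGenFun_eq {a b M m : ℕ} (hb : 0 < b) (hba : b ≤ a) {c : ℤ[X]}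
    (h : (1 - X ^ b) * boxGenFun M m = (1 - X ^ a) * c) (k : ℕ) : 0 ≤ c.coeff k := by
  have ha : 0 < a := hb.trans_le hba
  have hc : c ≠ 0 := right_ne_zero_of_mul
    (h ▸ mul_ne_zero (one_sub_X_pow_ne_zero hb) (boxGenFun_ne_zero M m))
  have hdeg : b + M * m = a + c.natDegree := by
    have := congrArg natDegree h
    rwa [natDegree_mul (one_sub_X_pow_ne_zero hb) (boxGenFun_ne_zero M m),
      natDegree_mul (one_sub_X_pow_ne_zero ha) hc, natDegree_one_sub_X_pow,
      natDegree_one_sub_X_pow, natDegree_boxGenFun] at this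
  have hrev : c.reverse = c := by
    have := congrArg reverse h
    rw [reverse_mul_of_domain, reverse_mul_of_domain, reverse_one_sub_X_pow,
      reverse_one_sub_X_pow, reverse_boxGenFun] at this
    refine mul_left_cancel₀ (one_sub_X_pow_ne_zero ha) ?_
    linear_combination h + this
  have low : ∀ i, 2 * i ≤ c.natDegree → 0 ≤ c.coeff i := by
    intro i
    induction i using Nat.strong_induction_on with
    | _ i ih =>
      intro hi
      have hcoeff := congrArg (coeff · i) h
      simp only [sub_mul, one_mul, coeff_sub, coeff_X_pow_mul'] at hcoeff
      have h1 : (if b ≤ i then (boxGenFun M m).coeff (i - b) else 0) ≤ (boxGenFun M m).coeff i := by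
        split_ifs
        · exact coeff_boxGenFun_mono (by omega) (by omega)
        · rw [coeff_boxGenFun]; positivity
      have h2 : 0 ≤ if a ≤ i then c.coeff (i - a) else 0 := by
        split_ifs
        · exact ih _ (by omega) (by omega)
        · rfl
      linarith
  by_cases hk : 2 * k ≤ c.natDegree
  · exact low k hk
  · by_cases hk' : k ≤ c.natDegree
    · rw [← hrev, coeff_reverse, revAt_le hk']
      exact low _ (by omega)
    · rw [coeff_eq_zero_of_natDegree_lt (by omega)]

theorem aIsNatPoly_iff_dvd {a b m n : ℕ} (hb : 0 < b) (hba : b ≤ a) (hmn : m ≤ n) :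
    AIsNatPoly b a n m ↔ (1 - X ^ a : ℤ[X]) ∣ (1 - X ^ b) * boxGenFun (n - m) m := by
  have hG : boxGenFun (n - m) m * (qProd m * qProd (n - m)) = qProd n := by
    rw [boxGenFun_mul_qProd, Nat.add_sub_cancel' hmn]
  have hQ := mul_ne_zero (qProd_ne_zero m) (qProd_ne_zero (n - m))
  constructor
  · rintro ⟨c, hc, -⟩
    change (1 - X ^ b) * qProd n = ((1 - X ^ a) * qProd m * qProd (n - m)) * c at hc
    refine ⟨c, mul_right_cancel₀ hQ ?_⟩
    linear_combination hc + (1 - X ^ b) * hG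
  · rintro ⟨c, hc⟩
    refine ⟨c, ?_, coeff_nonneg_of_mul_boxGenFun_eq hb hba hc⟩
    change (1 - X ^ b) * qProd n = ((1 - X ^ a) * qProd m * qProd (n - m)) * c
    linear_combination (qProd m * qProd (n - m)) * hc - (1 - X ^ b) * hG

theorem rootMultiplicity_one_sub_X_pow {d : ℕ} {ζ : ℂ} (hζ : IsPrimitiveRoot ζ d) {i : ℕ}
    (hi : 0 < i) : rootMultiplicity ζ (1 - X ^ i : ℂ[X]) = if d ∣ i then 1 else 0 := by
  have hne : (1 - X ^ i : ℂ[X]) ≠ 0 := one_sub_X_pow_ne_zero hi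
  have hroot : IsRoot (1 - X ^ i : ℂ[X]) ζ ↔ d ∣ i := by
    rw [← hζ.pow_eq_one_iff_dvd]
    simp [sub_eq_zero, eq_comm (a := (1 : ℂ))]
  split_ifs with h
  · have hsep : (X ^ i - 1 : ℂ[X]).Separable :=
      X_pow_sub_one_separable_iff.mpr (by exact_mod_cast hi.ne')
    exact le_antisymm
      (rootMultiplicity_le_one_of_separable (hsep.of_dvd ((dvd_sub_comm).mp dvd_rfl)) ζ)
      ((rootMultiplicity_pos hne).mpr (hroot.mpr h))
  · exact rootMultiplicity_eq_zero (mt hroot.mp h)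

theorem map_qProd_ne_zero (n : ℕ) : (qProd n).map (Int.castRingHom ℂ) ≠ 0 :=
  (Polynomial.map_ne_zero_iff (Int.castRingHom ℂ).injective_int).mpr (qProd_ne_zero n)

theorem rootMultiplicity_map_qProd {d : ℕ} {ζ : ℂ} (hζ : IsPrimitiveRoot ζ d) (n : ℕ) :
    rootMultiplicity ζ ((qProd n).map (Int.castRingHom ℂ)) = n / d := by
  induction n with
  | zero => simp [qProd_zero]
  | succ n ih =>
    have hne := map_qProd_ne_zero (n + 1)
    rw [qProd_succ, Polynomial.map_mul] at hne ⊢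
    rw [rootMultiplicity_mul hne, ih, Nat.succ_div]
    congr 1
    simpa using rootMultiplicity_one_sub_X_pow hζ n.succ_pos

theorem isRoot_map_boxGenFun_iff {d m n : ℕ} {ζ : ℂ} (hζ : IsPrimitiveRoot ζ d) (hd : 0 < d)
    (hmn : m ≤ n) :
    IsRoot ((boxGenFun (n - m) m).map (Int.castRingHom ℂ)) ζ ↔ n % d < m % d := by
  obtain ⟨k, rfl⟩ := Nat.exists_eq_add_of_le hmn
  rw [Nat.add_sub_cancel_left]
  have h := congrArg (map (Int.castRingHom ℂ)) (boxGenFun_mul_qProd k m)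
  rw [Polynomial.map_mul, Polynomial.map_mul] at h
  have hne := h ▸ map_qProd_ne_zero (m + k)
  replace h := congrArg (rootMultiplicity ζ) h
  rw [rootMultiplicity_mul hne, rootMultiplicity_mul (right_ne_zero_of_mul hne),
    rootMultiplicity_map_qProd hζ, rootMultiplicity_map_qProd hζ, rootMultiplicity_map_qProd hζ,
    Nat.add_div hd] at h
  rw [← rootMultiplicity_pos (left_ne_zero_of_mul hne), Nat.add_mod_eq_ite]
  have := Nat.mod_lt m hd
  have := Nat.mod_lt k hd
  split_ifs at h ⊢ <;> omega

theorem one_sub_X_pow_dvd_iff {a : ℕ} (ha : 0 < a) (P : ℤ[X]) :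
    (1 - X ^ a : ℤ[X]) ∣ P ↔ ∀ ζ : ℂ, ζ ^ a = 1 → IsRoot (P.map (Int.castRingHom ℂ)) ζ := by
  rw [← neg_dvd, neg_sub, ← map_dvd_map (Int.castRingHom ℂ) (Int.castRingHom ℂ).injective_int
    (by simpa using monic_X_pow_sub_C (1 : ℤ) ha.ne')]
  simp only [Polynomial.map_sub, Polynomial.map_pow, map_X, Polynomial.map_one]
  constructor
  · intro h ζ hζ
    exact IsRoot.dvd (by simp [hζ]) h
  · intro h
    rw [X_pow_sub_one_eq_prod ha (Complex.isPrimitiveRoot_exp a ha.ne')]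
    refine prod_dvd_of_coprime (fun x _ y _ hxy => ?_) fun ζ hζ => ?_
    · exact pairwise_coprime_X_sub_C Function.injective_id hxy
    · exact dvd_iff_isRoot.mpr (h ζ ((mem_nthRootsFinset ha 1).mp hζ))

theorem aIsNatPoly_iff_mod_lt {a b m n : ℕ} (ha : 0 < a) (hba : b ≤ a) (hmn : m ≤ n) :
    AIsNatPoly b a n m ↔ ∀ d, d ∣ a → ¬d ∣ b → n % d < m % d := by
  rcases b.eq_zero_or_pos with rfl | hb
  · exact iff_of_true ⟨0, by simp, by simp⟩ fun d _ h => absurd (dvd_zero d) h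
  rw [aIsNatPoly_iff_dvd hb hba hmn, one_sub_X_pow_dvd_iff ha]
  have hroot : ∀ {d : ℕ} {ζ : ℂ}, IsPrimitiveRoot ζ d → 0 < d →
      (IsRoot (((1 - X ^ b) * boxGenFun (n - m) m).map (Int.castRingHom ℂ)) ζ ↔
        (¬d ∣ b → n % d < m % d)) := by
    intro d ζ hζ hd
    rw [Polynomial.map_mul, root_mul, isRoot_map_boxGenFun_iff hζ hd hmn,
      ← hζ.pow_eq_one_iff_dvd, ← or_iff_not_imp_left]
    simp [sub_eq_zero, eq_comm (a := (1 : ℂ))]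
  constructor
  · intro h d hda
    have hd := Nat.pos_of_dvd_of_pos hda ha
    have hζ := Complex.isPrimitiveRoot_exp d hd.ne'
    exact (hroot hζ hd).mp (h _ ((hζ.pow_eq_one_iff_dvd a).mpr hda))
  · intro h ζ hζa
    exact (hroot (IsPrimitiveRoot.orderOf ζ)
      (orderOf_pos_iff.mpr (isOfFinOrder_iff_pow_eq_one.mpr ⟨a, ha, hζa⟩))).mpr
      (h _ (orderOf_dvd_of_pow_eq_one hζa))

theorem toNat_add_mul_mod {a d n : ℕ} (hd : d ∣ a) {l : ℤ} (h : 0 ≤ (n : ℤ) + l * a) :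
    ((n : ℤ) + l * a).toNat % d = n % d := by
  obtain ⟨e, rfl⟩ := hd
  rw [← Int.natCast_inj, Int.natCast_mod, Int.natCast_mod, Int.toNat_of_nonneg h]
  push_cast
  rw [show (n : ℤ) + l * (d * e) = n + d * (l * e) by ring, Int.add_mul_emod_self_left]

theorem stmt1 (a : ℕ) (b m n : ℕ) (ha : 0 < a) (hba : b ≤ a) (hmn : m ≤ n) :
    AIsNatPoly b a n m ↔
      ∀ k l : ℤ, 0 ≤ (m : ℤ) + k * a → (m : ℤ) + k * a ≤ (n : ℤ) + l * a →
        AIsNatPoly b a ((n : ℤ) + l * a).toNat ((m : ℤ) + k * a).toNat := by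
  constructor
  · intro h k l hk hkl
    rw [aIsNatPoly_iff_mod_lt ha hba hmn] at h
    rw [aIsNatPoly_iff_mod_lt ha hba (Int.toNat_le_toNat hkl)]
    intro d hda hdb
    rw [toNat_add_mul_mod hda hk, toNat_add_mul_mod hda (hk.trans hkl)]
    exact h d hda hdb
  · intro h
    simpa using h 0 0 (by simp) (by simpa using hmn)
end

section
/- Let a be a positive integer and b, m, n nonnegative integers with m ≤ n. Write m = ua + r and n = va + s with 0 ≤ r < a and a ≤ s < 2a (so that A(b,a;s,r) is the reduced form of A(b,a;n,m)). Then A(b,a;n,m) ∈ ℤ[q] if and only if A(b,a;s,r) ∈ ℤ[q]. -/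
open Polynomial Finset

/-- `A(b,a;n,m) ∈ ℤ[q]`: the polynomial `(1-q^a)·∏_{i=1}^m (1-q^i)·∏_{i=1}^{n-m} (1-q^i)`
divides `(1-q^b)·∏_{i=1}^n (1-q^i)` in `ℤ[q]`. -/
def AIsPoly (b a n m : ℕ) : Prop :=
  ((1 - X ^ a) * (∏ i ∈ range m, (1 - X ^ (i + 1))) *
      ∏ i ∈ range (n - m), (1 - X ^ (i + 1)) : Polynomial ℤ) ∣
    (1 - X ^ b) * ∏ i ∈ range n, (1 - X ^ (i + 1))

theorem one_sub_X_pow_associated_prod_cyclotomic {n N : ℕ} (hn : 0 < n) (hN : n ≤ N) :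
    Associated (1 - X ^ n : ℤ[X])
      (∏ d ∈ Icc 1 N, cyclotomic d ℤ ^ (if d ∣ n then 1 else 0)) := by
  have h : ∏ d ∈ Icc 1 N, cyclotomic d ℤ ^ (if d ∣ n then 1 else 0) = X ^ n - 1 := by
    rw [← prod_cyclotomic_eq_X_pow_sub_one hn ℤ]
    symm
    apply Finset.prod_subset_one_on_sdiff
    · intro d hd
      have hdvd := Nat.dvd_of_mem_divisors hd
      exact mem_Icc.2 ⟨Nat.pos_of_dvd_of_pos hdvd hn, (Nat.le_of_dvd hn hdvd).trans hN⟩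
    · intro d hd
      have : ¬ d ∣ n := fun hdvd ↦ (mem_sdiff.1 hd).2 (Nat.mem_divisors.2 ⟨hdvd, hn.ne'⟩)
      simp [this]
    · intro d hd
      simp [Nat.dvd_of_mem_divisors hd]
  rw [h, ← neg_sub]
  exact (Associated.refl _).neg_left

theorem prod_one_sub_X_pow_associated_prod_cyclotomic {n N : ℕ} (hN : n ≤ N) :
    Associated (∏ i ∈ range n, (1 - X ^ (i + 1)) : ℤ[X])
      (∏ d ∈ Icc 1 N, cyclotomic d ℤ ^ (n / d)) := by
  induction n with
  | zero => simp
  | succ n ih =>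
    simp_rw [Nat.succ_div, pow_add (cyclotomic _ ℤ)]
    rw [Finset.prod_range_succ, Finset.prod_mul_distrib]
    exact (ih (by lia)).mul_mul (one_sub_X_pow_associated_prod_cyclotomic n.succ_pos hN)

theorem prod_cyclotomic_pow_dvd_iff {S : Finset ℕ} (hS : ∀ d ∈ S, 0 < d) (e f : ℕ → ℕ) :
    (∏ d ∈ S, cyclotomic d ℤ ^ e d) ∣ (∏ d ∈ S, cyclotomic d ℤ ^ f d) ↔
      ∀ d ∈ S, e d ≤ f d := by
  refine ⟨fun h d hd ↦ ?_, fun h ↦ Finset.prod_dvd_prod_of_dvd _ _ fun d hd ↦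
    pow_dvd_pow _ (h d hd)⟩
  have hirr := cyclotomic.irreducible (hS d hd)
  have hdvd := (Finset.dvd_prod_of_mem (fun d ↦ cyclotomic d ℤ ^ e d) hd).trans h
  rw [← Finset.mul_prod_erase S _ hd] at hdvd
  have hnot : ¬ cyclotomic d ℤ ∣ ∏ k ∈ S.erase d, cyclotomic k ℤ ^ f k := by
    intro hk
    obtain ⟨k, hk, hdk⟩ := hirr.prime.exists_mem_finset_dvd hk
    obtain ⟨hkd, hkS⟩ := mem_erase.1 hk
    have hass := hirr.associated_of_dvd (cyclotomic.irreducible (hS k hkS))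
      (hirr.prime.dvd_of_dvd_pow hdk)
    exact hkd (cyclotomic_injective (R := ℤ) (eq_of_monic_of_associated
      (cyclotomic.monic d ℤ) (cyclotomic.monic k ℤ) hass)).symm
  exact (pow_dvd_pow_iff hirr.ne_zero hirr.not_isUnit).1
    (hirr.prime.pow_dvd_of_dvd_mul_right _ hnot hdvd)

theorem ite_dvd_add_div_le_iff {a b m k d : ℕ} (hd : 0 < d) :
    (if d ∣ a then 1 else 0) + m / d + k / d ≤ (if d ∣ b then 1 else 0) + (m + k) / d ↔
      (d ∣ a → d ∣ b ∨ (m + k) % d < m % d) := by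
  have hcarry : (m + k) % d < m % d ↔ d ≤ m % d + k % d := by
    have hm := Nat.mod_lt m hd
    have hk := Nat.mod_lt k hd
    have := Nat.add_mod_add_ite m k d
    split_ifs at this <;> lia
  rw [hcarry, Nat.add_div hd]
  split_ifs <;> simp_all <;> lia

theorem aIsPoly_iff {a b m n : ℕ} (ha : 0 < a) (hmn : m ≤ n) :
    AIsPoly b a n m ↔ ∀ d, d ∣ a → d ∣ b ∨ n % d < m % d := by
  rcases b.eq_zero_or_pos with rfl | hb
  · simp [AIsPoly]
  obtain ⟨k, rfl⟩ := Nat.exists_eq_add_of_le hmn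
  have hP {l : ℕ} (hl : l ≤ a + b + (m + k)) :=
    prod_one_sub_X_pow_associated_prod_cyclotomic hl
  have hX {l : ℕ} (h0 : 0 < l) (hl : l ≤ a + b + (m + k)) :=
    one_sub_X_pow_associated_prod_cyclotomic h0 hl
  have hl := ((hX (l := a) ha (by lia)).mul_mul (hP (l := m) (by lia))).mul_mul
    (hP (l := k) (by lia))
  have hr := (hX (l := b) hb (by lia)).mul_mul (hP (l := m + k) (by lia))
  rw [AIsPoly, Nat.add_sub_cancel_left, hl.dvd_iff_dvd_left, hr.dvd_iff_dvd_right]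
  simp only [← Finset.prod_mul_distrib, ← pow_add]
  rw [prod_cyclotomic_pow_dvd_iff fun d hd ↦ (mem_Icc.1 hd).1]
  constructor
  · intro h d hda
    have hd := Nat.pos_of_dvd_of_pos hda ha
    have := Nat.le_of_dvd ha hda
    exact (ite_dvd_add_div_le_iff hd).1 (h d (mem_Icc.2 ⟨hd, by lia⟩)) hda
  · intro h d hd
    exact (ite_dvd_add_div_le_iff (mem_Icc.1 hd).1).2 (h d)

theorem stmt12 (a b m n u r v s : ℕ) (ha : 0 < a) (hmn : m ≤ n)
    (hm : m = u * a + r) (hr : r < a)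
    (hn : n = v * a + s) (hs1 : a ≤ s) (hs2 : s < 2 * a) :
    AIsPoly b a n m ↔ AIsPoly b a s r := by
  rw [aIsPoly_iff ha hmn, aIsPoly_iff ha (hr.le.trans hs1)]
  refine forall₂_congr fun d hd ↦ ?_
  obtain ⟨c, rfl⟩ := hd
  have hmod (w t : ℕ) : (w * (d * c) + t) % d = t % d := by
    rw [mul_left_comm, Nat.mul_add_mod]
  rw [hm, hn, hmod, hmod]
end
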